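/- arXiv:1805.05998 — 2 statements merged into one kernel-verified Lean document; each statement's English description precedes it below -/
import Mathlib

section
/- (Noncommutative Dini theorem) Let A be a separable unital C*-algebra with compact generating set K that is compact (Σ(A) is a compact subset of (Rep(A), d_K)). Let (a_n) be a sequence in A that is increasing with respect to the canonical order on A (a_n ≤ a_{n+1} for all n) and let a ∈ A be such that for every π ∈ Σ(A), ‖π(a_n) − π(a)‖ → 0 as n → ∞. Then ‖a_n − a‖ → 0. -/
noncomputable section

abbrev H2 : Type := lp (fun _ : ℕ => ℂ) 2
abbrev BH : Type := H2 →L[ℂ] H2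

abbrev RepSp (A : Type*) [CStarAlgebra A] := A →⋆ₐ[ℂ] BH

def Generates {A : Type*} [CStarAlgebra A] (K : Set A) : Prop :=
  (StarAlgebra.adjoin ℂ K).topologicalClosure = ⊤

def dRep {A : Type*} [CStarAlgebra A] (K : Set A) (π₁ π₂ : RepSp A) : ℝ :=
  ⨆ a ∈ K, ‖π₁ a - π₂ a‖

abbrev lpE (n : ℕ) : Type := lp (fun _ : ℕ => EuclideanSpace ℂ (Fin n)) 2

/-- A representation is irreducible if its commutant is trivial. -/
def IsIrredRep {A : Type*} [CStarAlgebra A] (π : RepSp A) : Prop :=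
  ∀ T : BH, (∀ a : A, T * π a = π a * T) → ∃ c : ℂ, T = c • (1 : BH)

/-- `Σ⁰(A)`: irreducible representations on `ℓ²`, together with the countable
amplifications `ℵ₀ ⊙ ρ` of finite-dimensional irreducible representations `ρ`. -/
def Sigma0 (A : Type*) [CStarAlgebra A] : Set (RepSp A) :=
  {π | IsIrredRep π ∨
    ∃ n : ℕ, 0 < n ∧ ∃ ρ : A →⋆ₐ[ℂ] Matrix (Fin n) (Fin n) ℂ,
      (∀ T : Matrix (Fin n) (Fin n) ℂ, (∀ a : A, T * ρ a = ρ a * T) →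
        ∃ c : ℂ, T = c • (1 : Matrix (Fin n) (Fin n) ℂ)) ∧
      ∃ u : H2 ≃ₗᵢ[ℂ] lpE n, ∀ (a : A) (f : lpE n) (k : ℕ),
        u (π a (u.symm f)) k = Matrix.toEuclideanLin (ρ a) (f k)}

/-- `Σ(A)`: the closure of `Σ⁰(A)` with respect to the metric `d_K`. -/
def SigmaSet {A : Type*} [CStarAlgebra A] (K : Set A) : Set (RepSp A) :=
  {π | ∀ ε > (0 : ℝ), ∃ π' ∈ Sigma0 A, dRep K π π' < ε}

/-- Sequential compactness of a set of representations with respect to `d_K`;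
for the metric space `(Rep(A), d_K)` this is equivalent to compactness. -/
def RepSeqCompact {A : Type*} [CStarAlgebra A] (K : Set A) (S : Set (RepSp A)) : Prop :=
  ∀ u : ℕ → RepSp A, (∀ n, u n ∈ S) →
    ∃ π ∈ S, ∃ φ : ℕ → ℕ, StrictMono φ ∧
      Filter.Tendsto (fun n => dRep K (u (φ n)) π) Filter.atTop (nhds 0)

theorem WeakDual.locallyConvexSpace_real (A : Type*) [NormedAddCommGroup A] [NormedSpace ℂ A] :
    LocallyConvexSpace ℝ (WeakDual ℂ A) :=
  LocallyConvexSpace.induced (t := Pi.topologicalSpace (Y := fun _ : A => ℂ))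
    { toFun := fun (f : WeakDual ℂ A) (x : A) => f x
      map_add' := fun _ _ => rfl
      map_smul' := fun _ _ => rfl }

theorem norm_one_add_of_nonneg {A : Type*} [CStarAlgebra A] [PartialOrder A] [StarOrderedRing A]
    [Nontrivial A] {c : A} (hc : 0 ≤ c) : ‖1 + c‖ = 1 + ‖c‖ := by
  refine le_antisymm ((norm_add_le _ _).trans (by simp)) ?_
  have h := CStarAlgebra.norm_mem_spectrum_of_nonneg (a := c) hc
  have h2 : 1 + ‖c‖ ∈ spectrum ℝ (1 + c) := by
    have := spectrum.add_mem_add_iff (R := ℝ) (a := c) (r := ‖c‖) (s := 1)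
    simpa [add_comm] using this.2 h
  have h3 := spectrum.norm_le_norm_of_mem h2
  rwa [Real.norm_of_nonneg (by positivity)] at h3

theorem exists_extremal_functional {A : Type*} [CStarAlgebra A] [PartialOrder A]
    [StarOrderedRing A] [Nontrivial A] {c : A} (hc : 0 ≤ c) :
    ∃ f : StrongDual ℂ A, ‖f‖ ≤ 1 ∧ f 1 = 1 ∧ f c = ‖c‖ ∧
      ∀ g : StrongDual ℂ A, ‖f + g‖ ≤ 1 → ‖f - g‖ ≤ 1 → g = 0 := by
  let F : Set (WeakDual ℂ A) :=
    WeakDual.toStrongDual ⁻¹' Metric.closedBall 0 1 ∩ {f | f (1 + c) = ((1 + ‖c‖ : ℝ) : ℂ)}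
  have hFc : IsCompact F := (WeakDual.isCompact_closedBall 0 1).inter_right
    (isClosed_eq (WeakDual.eval_continuous _) continuous_const)
  have hFne : F.Nonempty := by
    obtain ⟨f, hf, hfc⟩ := exists_dual_vector'' ℂ (1 + c)
    refine ⟨StrongDual.toWeakDual f, ?_, ?_⟩
    · simpa using hf
    · rw [norm_one_add_of_nonneg hc] at hfc
      simpa using hfc
  have := WeakDual.locallyConvexSpace_real A
  obtain ⟨f, hf⟩ := hFc.extremePoints_nonempty hFne
  have key : ∀ g : StrongDual ℂ A, ‖g‖ ≤ 1 → ‖g 1‖ ≤ 1 ∧ ‖g c‖ ≤ ‖c‖ := fun g hg =>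
    ⟨by simpa using g.le_of_opNorm_le hg 1, by simpa using g.le_of_opNorm_le hg c⟩
  have mem_iff : ∀ g : StrongDual ℂ A, StrongDual.toWeakDual g ∈ F ↔
      ‖g‖ ≤ 1 ∧ g (1 + c) = ((1 + ‖c‖ : ℝ) : ℂ) := by
    intro g
    simp [F]
  have re_eq : ∀ (z : ℂ) (r : ℝ), ‖z‖ ≤ r → r ≤ z.re → z = r := by
    intro z r h1 h2
    have h3 := Complex.re_le_norm z
    have h4 : z.re = ‖z‖ := by linarith
    have h5 := Complex.re_eq_norm.1 h4
    apply Complex.ext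
    · simp; linarith
    · simpa using h5.2.symm
  set f' : StrongDual ℂ A := WeakDual.toStrongDual f with hf'
  have hfF := (mem_iff f').1 hf.1
  have hre : (f' 1).re + (f' c).re = 1 + ‖c‖ := by
    have := congrArg Complex.re hfF.2
    simpa using this
  obtain ⟨k1, k2⟩ := key f' hfF.1
  have r1 := Complex.re_le_norm (f' 1)
  have r2 := Complex.re_le_norm (f' c)
  refine ⟨f', hfF.1, by simpa using re_eq _ 1 k1 (by linarith), re_eq _ _ k2 (by linarith), ?_⟩
  intro g h1 h2
  have hg0 : g (1 + c) = 0 := by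
    have e1 := (f' + g).le_of_opNorm_le h1 (1 + c)
    have e2 := (f' - g).le_of_opNorm_le h2 (1 + c)
    rw [norm_one_add_of_nonneg hc, one_mul] at e1 e2
    simp only [_root_.add_apply, _root_.sub_apply, hfF.2] at e1 e2
    have q1 := Complex.re_le_norm (((1 + ‖c‖ : ℝ) : ℂ) + g (1 + c))
    have q2 := Complex.re_le_norm (((1 + ‖c‖ : ℝ) : ℂ) - g (1 + c))
    rw [Complex.add_re, Complex.ofReal_re] at q1
    rw [Complex.sub_re, Complex.ofReal_re] at q2
    have := re_eq (((1 + ‖c‖ : ℝ) : ℂ) + g (1 + c)) _ e1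
      (by rw [Complex.add_re, Complex.ofReal_re]; linarith)
    simpa using this
  have m1 : StrongDual.toWeakDual (f' + g) ∈ F := (mem_iff _).2 ⟨h1, by simp [hg0, hfF.2, -map_add]⟩
  have m2 : StrongDual.toWeakDual (f' - g) ∈ F := (mem_iff _).2 ⟨h2, by simp [hg0, hfF.2, -map_add]⟩
  have := hf.2 m1 m2 ⟨1 / 2, 1 / 2, by norm_num, by norm_num, by norm_num, by
    refine DFunLike.ext _ _ fun x => ?_
    change (1 / 2 : ℝ) • (f' x + g x) + (1 / 2 : ℝ) • (f' x - g x) = f' x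
    simp only [Complex.real_smul]
    push_cast
    ring⟩
  have h3 : f' + g = f' := congrArg WeakDual.toStrongDual this
  simpa using h3

open ComplexOrder in
theorem apply_nonneg_of_norm_le_one {A : Type*} [CStarAlgebra A] [PartialOrder A]
    [StarOrderedRing A] (f : StrongDual ℂ A) (hf : ‖f‖ ≤ 1) (h1 : f 1 = 1) {x : A}
    (hx : 0 ≤ x) : 0 ≤ f x := by
  rcases subsingleton_or_nontrivial A with hA | hA
  · simp [Subsingleton.elim x 0]
  have hxs : star x = x := (IsSelfAdjoint.of_nonneg hx)
  rw [Complex.nonneg_iff]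
  constructor
  · have h2 : ‖algebraMap ℝ A ‖x‖ - x‖ ≤ ‖x‖ := by
      have h0 : 0 ≤ algebraMap ℝ A ‖x‖ - x :=
        sub_nonneg.2 (IsSelfAdjoint.le_algebraMap_norm_self (IsSelfAdjoint.of_nonneg hx))
      have h3 : algebraMap ℝ A ‖x‖ - x ≤ algebraMap ℝ A ‖x‖ := sub_le_self _ hx
      exact (CStarAlgebra.norm_le_iff_le_algebraMap _ (norm_nonneg x) h0).2 h3
    have h3 := (f.le_of_opNorm_le hf (algebraMap ℝ A ‖x‖ - x)).trans (by simpa using h2)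
    have h4 : f (algebraMap ℝ A ‖x‖ - x) = ‖x‖ - f x := by
      have : algebraMap ℝ A ‖x‖ = (‖x‖ : ℂ) • (1 : A) := by
        simp [Algebra.algebraMap_eq_smul_one]
      rw [map_sub, this, map_smul, h1]
      simp
    rw [h4] at h3
    have h5 := (Complex.re_le_norm _).trans h3
    simp at h5
    exact h5
  · have key : ∀ t : ℝ, ((f x).im + t) ^ 2 ≤ ‖x‖ ^ 2 + t ^ 2 := by
      intro t
      have e1 : star (x + (Complex.I * t) • (1 : A)) * (x + (Complex.I * t) • (1 : A)) =
          x * x + ((t ^ 2 : ℝ) : ℂ) • (1 : A) := by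
        simp only [star_add, star_smul, star_one, hxs, add_mul, mul_add, smul_mul_assoc,
          mul_smul_comm, one_mul, mul_one]
        have : star (Complex.I * (t : ℂ)) = -(Complex.I * t) := by simp
        have h2 : (Complex.I * t) * -(Complex.I * t) = ((t ^ 2 : ℝ) : ℂ) := by
          push_cast; ring_nf; simp
        rw [this, ← h2]
        module
      have e2 : ‖x + (Complex.I * t) • (1 : A)‖ ^ 2 ≤ ‖x‖ ^ 2 + t ^ 2 := by
        rw [sq, ← CStarRing.norm_star_mul_self, e1]
        refine (norm_add_le _ _).trans ?_
        refine add_le_add ((norm_mul_le _ _).trans (by rw [sq])) ?_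
        rw [norm_smul, Complex.norm_real]
        simp
      have e3 := f.le_of_opNorm_le hf (x + (Complex.I * t) • (1 : A))
      rw [map_add, map_smul, h1, one_mul] at e3
      have e4 := (Complex.abs_im_le_norm _).trans e3
      have e5 : (f x + (Complex.I * t) • (1 : ℂ)).im = (f x).im + t := by simp
      rw [e5] at e4
      calc _ = |(f x).im + t| ^ 2 := (sq_abs _).symm
        _ ≤ _ := pow_le_pow_left₀ (abs_nonneg _) e4 2
        _ ≤ _ := e2
    by_contra hne
    set β := (f x).im
    have hβ : β ≠ 0 := fun h => hne h.symm
    have := key ((‖x‖ ^ 2 + 1) / (2 * β))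
    have e : β * ((‖x‖ ^ 2 + 1) / (2 * β)) * 2 = ‖x‖ ^ 2 + 1 := by field_simp
    nlinarith [sq_nonneg β]

/-- The diagonal amplification of a bounded operator to the countable `ℓ²`-direct sum. -/
def lpMap {E : Type*} [NormedAddCommGroup E] [InnerProductSpace ℂ E] (T : E →L[ℂ] E) :
    lp (fun _ : ℕ => E) 2 →L[ℂ] lp (fun _ : ℕ => E) 2 :=
  LinearMap.mkContinuous
    { toFun := fun f => ⟨fun k => T (f k), by
        refine Memℓp.mono' (f := fun k => T (f k)) (g := ‖T‖ • ⇑f) ((lp.memℓp f).const_smul ‖T‖) ?_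
        intro i
        simpa [norm_smul] using T.le_opNorm (f i)⟩
      map_add' := fun f g => by ext k; simp; rfl
      map_smul' := fun c f => by ext k; simp } ‖T‖ (by
    intro f
    have : ‖‖T‖ • f‖ = ‖T‖ * ‖f‖ := by rw [norm_smul]; simp
    rw [← this]
    refine lp.norm_mono (by norm_num) ?_
    intro i
    simpa [norm_smul] using T.le_opNorm (f i))

@[simp]
theorem lpMap_apply {E : Type*} [NormedAddCommGroup E] [InnerProductSpace ℂ E] (T : E →L[ℂ] E)
    (f : lp (fun _ : ℕ => E) 2) (k : ℕ) : lpMap T f k = T (f k) := rfl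

/-- Diagonal amplification as a star algebra homomorphism. -/
def lpMapStarAlgHom (E : Type*) [NormedAddCommGroup E] [InnerProductSpace ℂ E] [CompleteSpace E] :
    (E →L[ℂ] E) →⋆ₐ[ℂ] (lp (fun _ : ℕ => E) 2 →L[ℂ] lp (fun _ : ℕ => E) 2) where
  toFun := lpMap
  map_one' := by ext f k; simp
  map_mul' S T := by ext f k; simp
  map_zero' := by ext f k; simp
  map_add' S T := by ext f k; simp
  commutes' r := by ext f k; simp [Algebra.algebraMap_eq_smul_one]
  map_star' T := by
    rw [ContinuousLinearMap.star_eq_adjoint, ContinuousLinearMap.star_eq_adjoint,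
      ContinuousLinearMap.eq_adjoint_iff]
    intro f g
    simp [lp.inner_eq_tsum, ContinuousLinearMap.adjoint_inner_left]

theorem norm_le_norm_lpMap {E : Type*} [NormedAddCommGroup E] [InnerProductSpace ℂ E]
    (T : E →L[ℂ] E) : ‖T‖ ≤ ‖lpMap T‖ := by
  refine T.opNorm_le_bound (norm_nonneg (lpMap T)) fun x => ?_
  have h1 := (lpMap T).le_opNorm (lp.single 2 0 x)
  rw [lp.norm_single (by norm_num)] at h1
  refine le_trans ?_ h1
  have := lp.norm_apply_le_norm (p := 2) (by norm_num) (lpMap T (lp.single 2 0 x)) 0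
  simpa using this

theorem Orthonormal.countable_of_separable {ι H : Type*} [NormedAddCommGroup H]
    [InnerProductSpace ℂ H] [TopologicalSpace.SeparableSpace H] {v : ι → H}
    (hv : Orthonormal ℂ v) : Countable ι := by
  refine Pairwise.countable_of_isOpen_disjoint (s := fun i => Metric.ball (v i) (1 / 2))
    (fun i j hij => ?_) (fun i => Metric.isOpen_ball)
    (fun i => ⟨v i, Metric.mem_ball_self (by norm_num)⟩)
  refine Metric.ball_disjoint_ball ?_
  have h : ‖v i - v j‖ ^ 2 = 2 := by
    rw [@norm_sub_sq ℂ, hv.1, hv.1, hv.2 hij]; norm_num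
  rw [dist_eq_norm]
  nlinarith [norm_nonneg (v i - v j)]

theorem HilbertBasis.nonempty_equiv_lp {ι H : Type*} [NormedAddCommGroup H]
    [InnerProductSpace ℂ H] [CompleteSpace H] (b : HilbertBasis ι ℂ H) (e : ℕ ≃ ι) :
    Nonempty (H ≃ₗᵢ[ℂ] lp (fun _ : ℕ => ℂ) 2) := by
  refine ⟨(HilbertBasis.mk (v := b ∘ e) (b.orthonormal.comp _ e.injective) ?_).repr⟩
  rw [e.surjective.range_comp]
  exact b.dense_span.ge

theorem nonempty_equiv_lp_of_separable (H : Type*) [NormedAddCommGroup H]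
    [InnerProductSpace ℂ H] [CompleteSpace H] [TopologicalSpace.SeparableSpace H]
    (hH : ¬ FiniteDimensional ℂ H) : Nonempty (H ≃ₗᵢ[ℂ] lp (fun _ : ℕ => ℂ) 2) := by
  obtain ⟨w, b, -⟩ := exists_hilbertBasis ℂ H
  have := b.orthonormal.countable_of_separable
  rcases finite_or_infinite w with hw | hw
  · exfalso
    apply hH
    have := Fintype.ofFinite w
    exact b.toOrthonormalBasis.toBasis.finiteDimensional_of_finite
  · obtain ⟨e⟩ := nonempty_equiv_of_countable (α := ℕ) (β := w)
    exact b.nonempty_equiv_lp e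

theorem nonempty_equiv_lp_lp {n : ℕ} (hn : 0 < n) :
    Nonempty (lp (fun _ : ℕ => ℂ) 2 ≃ₗᵢ[ℂ] lp (fun _ : ℕ => EuclideanSpace ℂ (Fin n)) 2) := by
  let v : ℕ × Fin n → lp (fun _ : ℕ => EuclideanSpace ℂ (Fin n)) 2 :=
    fun p => lp.single 2 p.1 (EuclideanSpace.single p.2 1)
  have hv : Orthonormal ℂ v := by
    rw [orthonormal_iff_ite]
    rintro ⟨i, j⟩ ⟨k, l⟩
    simp only [v, lp.inner_single_left, Prod.mk.injEq]
    by_cases h : i = k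
    · subst h
      have := (orthonormal_iff_ite.1 (EuclideanSpace.orthonormal_single (𝕜 := ℂ) (ι := Fin n))) j l
      simpa using this
    · simp [h]
  have hb : (Submodule.span ℂ (Set.range v))ᗮ = ⊥ := by
    rw [Submodule.eq_bot_iff]
    intro f hf
    ext k j
    have := (Submodule.mem_orthogonal _ _).1 hf (v (k, j)) (Submodule.subset_span ⟨_, rfl⟩)
    simpa [v, lp.inner_single_left, EuclideanSpace.inner_single_left] using this
  have : Nonempty (Fin n) := ⟨⟨0, hn⟩⟩
  obtain ⟨e⟩ := nonempty_equiv_of_countable (α := ℕ) (β := ℕ × Fin n)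
  obtain ⟨u⟩ := (HilbertBasis.mkOfOrthogonalEqBot hv hb).nonempty_equiv_lp e
  exact ⟨u.symm⟩

/-- A star homomorphism into the bounded operators has trivial commutant. -/
def HasTrivialCommutant {A H : Type*} [CStarAlgebra A] [NormedAddCommGroup H]
    [InnerProductSpace ℂ H] [CompleteSpace H] (π : A →⋆ₐ[ℂ] (H →L[ℂ] H)) : Prop :=
  ∀ T : H →L[ℂ] H, (∀ a, T * π a = π a * T) → ∃ c : ℂ, T = c • (1 : H →L[ℂ] H)

section Cyclic

variable {A H : Type*} [CStarAlgebra A] [NormedAddCommGroup H] [InnerProductSpace ℂ H]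
  [CompleteSpace H] (π : A →⋆ₐ[ℂ] (H →L[ℂ] H))

open scoped InnerProductSpace

theorem norm_inner_commutant_le (S : H →L[ℂ] H) (hS : 0 ≤ S) (hSπ : ∀ a, Commute S (π a))
    (ξ : H) (a : A) : ‖⟪S ξ, π a ξ⟫_ℂ‖ ≤ ‖⟪S ξ, ξ⟫_ℂ‖ * ‖a‖ := by
  set R := CFC.sqrt S
  have hRR : R * R = S := CFC.sqrt_mul_sqrt_self S
  have hRs : star R = R := IsSelfAdjoint.of_nonneg (CFC.sqrt_nonneg S)
  have hRπ : Commute R (π a) := (hSπ a).cfcₙ_nnreal _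
  have e : ∀ y, ⟪S ξ, y⟫_ℂ = ⟪R ξ, R y⟫_ℂ := by
    intro y
    rw [← hRR, mul_apply_eq_comp, ← ContinuousLinearMap.adjoint_inner_right,
      ← ContinuousLinearMap.star_eq_adjoint, hRs]
  have e2 : R (π a ξ) = π a (R ξ) := congrArg (fun T : H →L[ℂ] H => T ξ) hRπ.eq
  rw [e, e, e2, inner_self_eq_norm_sq_to_K]
  calc _ ≤ ‖R ξ‖ * ‖π a (R ξ)‖ := norm_inner_le_norm _ _
    _ ≤ ‖R ξ‖ * (‖a‖ * ‖R ξ‖) := by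
      gcongr
      exact (π a).le_of_opNorm_le (NonUnitalStarAlgHom.norm_apply_le π a) _
    _ = _ := by simp; ring

theorem eq_zero_of_extremal (ξ : H) (hξ : DenseRange fun a => π a ξ) (hξ1 : ‖ξ‖ = 1)
    (f : StrongDual ℂ A) (hf : ∀ a, f a = ⟪ξ, π a ξ⟫_ℂ)
    (hext : ∀ g : StrongDual ℂ A, ‖f + g‖ ≤ 1 → ‖f - g‖ ≤ 1 → g = 0)
    (T : H →L[ℂ] H) (hT : IsSelfAdjoint T) (hTπ : ∀ a, Commute T (π a)) (hT1 : ‖T‖ ≤ 1)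
    (hTξ : ⟪T ξ, ξ⟫_ℂ = 0) : T = 0 := by
  obtain ⟨g, hg⟩ : ∃ g : StrongDual ℂ A, ∀ a, g a = ⟪T ξ, π a ξ⟫_ℂ :=
    ⟨LinearMap.mkContinuous
      { toFun := fun a => ⟪T ξ, π a ξ⟫_ℂ
        map_add' := fun a b => by simp
        map_smul' := fun c a => by simp } (‖T ξ‖ * ‖ξ‖) (fun a => by
      calc _ ≤ ‖T ξ‖ * ‖π a ξ‖ := norm_inner_le_norm _ _
        _ ≤ ‖T ξ‖ * (‖a‖ * ‖ξ‖) := by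
          gcongr
          exact (π a).le_of_opNorm_le (NonUnitalStarAlgHom.norm_apply_le π a) _
        _ = _ := by ring), fun a => rfl⟩
  have hpos : ∀ T' : H →L[ℂ] H, IsSelfAdjoint T' → ‖T'‖ ≤ 1 → 0 ≤ 1 + T' := by
    intro T' hT' hT1'
    have h1 := neg_le_iff_add_nonneg.1 (IsSelfAdjoint.neg_algebraMap_norm_le_self hT')
    have h2 : algebraMap ℝ (H →L[ℂ] H) ‖T'‖ ≤ 1 := by
      simpa using algebraMap_mono (H →L[ℂ] H) hT1'
    rw [add_comm]
    exact h1.trans (by gcongr)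
  have hbound : ∀ T' : H →L[ℂ] H, IsSelfAdjoint T' → ‖T'‖ ≤ 1 → (∀ a, Commute T' (π a)) →
      ⟪T' ξ, ξ⟫_ℂ = 0 → ∀ a, ‖⟪ξ, π a ξ⟫_ℂ + ⟪T' ξ, π a ξ⟫_ℂ‖ ≤ 1 * ‖a‖ := by
    intro T' h1 h2 h3 h4 a
    have := norm_inner_commutant_le π (1 + T') (hpos T' h1 h2)
      (fun a => (Commute.one_left _).add_left (h3 a)) ξ a
    simpa [inner_add_left, h4, hξ1, inner_self_eq_norm_sq_to_K] using this
  have hg0 : g = 0 := by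
    refine hext g ?_ ?_
    · refine ContinuousLinearMap.opNorm_le_bound _ zero_le_one fun a => ?_
      simpa [hf, hg] using hbound T hT hT1 hTπ hTξ a
    · refine ContinuousLinearMap.opNorm_le_bound _ zero_le_one fun a => ?_
      simpa [hf, hg, sub_eq_add_neg] using hbound (-T) hT.neg (by simpa using hT1)
        (fun a => (hTπ a).neg_left) (by simp [hTξ]) a
  have hTξ0 : T ξ = 0 := by
    have : ∀ y, ⟪T ξ, y⟫_ℂ = 0 := by
      refine fun y => hξ.induction_on (p := fun y => ⟪T ξ, y⟫_ℂ = 0) y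
        (isClosed_eq (by fun_prop) continuous_const) fun a => ?_
      rw [← hg, hg0]; rfl
    exact inner_self_eq_zero.1 (this _)
  ext y
  refine hξ.induction_on (p := fun y => T y = (0 : H →L[ℂ] H) y) y
    (isClosed_eq (by fun_prop) (by fun_prop)) fun a => ?_
  have : T (π a ξ) = π a (T ξ) := congrArg (fun T : H →L[ℂ] H => T ξ) (hTπ a).eq
  simp [this, hTξ0]

theorem exists_eq_smul_one_of_extremal (ξ : H) (hξ : DenseRange fun a => π a ξ) (hξ1 : ‖ξ‖ = 1)
    (f : StrongDual ℂ A) (hf : ∀ a, f a = ⟪ξ, π a ξ⟫_ℂ)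
    (hext : ∀ g : StrongDual ℂ A, ‖f + g‖ ≤ 1 → ‖f - g‖ ≤ 1 → g = 0)
    (T : H →L[ℂ] H) (hT : IsSelfAdjoint T) (hTπ : ∀ a, Commute T (π a)) :
    ∃ c : ℂ, T = c • (1 : H →L[ℂ] H) := by
  set r : ℂ := ⟪T ξ, ξ⟫_ℂ with hr
  have hrs : star r = r := by
    rw [hr, Complex.star_def, inner_conj_symm, ← ContinuousLinearMap.adjoint_inner_left,
      ← ContinuousLinearMap.star_eq_adjoint, hT.star_eq]
  obtain ⟨T₁, hT₁⟩ : ∃ T₁ : H →L[ℂ] H, T₁ = T - r • 1 := ⟨_, rfl⟩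
  have h1 : IsSelfAdjoint T₁ := hT₁ ▸ hT.sub (by simp [isSelfAdjoint_iff, hrs])
  have h2 : ⟪T₁ ξ, ξ⟫_ℂ = 0 := by
    simp [hT₁, ← hr, inner_self_eq_norm_sq_to_K, hξ1, hrs, -RCLike.star_def, -Complex.star_def]
  have h3 : ∀ a, Commute T₁ (π a) := fun a =>
    hT₁ ▸ (hTπ a).sub_left ((Commute.one_left _).smul_left r)
  have h5 : IsSelfAdjoint (((‖T₁‖⁻¹ : ℝ) : ℂ) • T₁) := by
    rw [isSelfAdjoint_iff, star_smul, h1.star_eq, Complex.star_def, Complex.conj_ofReal]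
  have h4 : ((‖T₁‖⁻¹ : ℝ) : ℂ) • T₁ = 0 := by
    refine eq_zero_of_extremal π ξ hξ hξ1 f hf hext _ h5 (fun a => (h3 a).smul_left _) ?_ ?_
    · rw [norm_smul, Complex.norm_real, norm_inv, norm_norm]
      exact inv_mul_le_one
    · rw [_root_.smul_apply, inner_smul_left, h2, mul_zero]
  refine ⟨r, sub_eq_zero.1 (hT₁ ▸ ?_)⟩
  rcases smul_eq_zero.1 h4 with h | h
  · exact norm_eq_zero.1 (inv_eq_zero.1 (Complex.ofReal_eq_zero.1 h))
  · exact h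

theorem hasTrivialCommutant_of_extremal (ξ : H) (hξ : DenseRange fun a => π a ξ) (hξ1 : ‖ξ‖ = 1)
    (f : StrongDual ℂ A) (hf : ∀ a, f a = ⟪ξ, π a ξ⟫_ℂ)
    (hext : ∀ g : StrongDual ℂ A, ‖f + g‖ ≤ 1 → ‖f - g‖ ≤ 1 → g = 0) :
    HasTrivialCommutant π := by
  have sa := exists_eq_smul_one_of_extremal π ξ hξ hξ1 f hf hext
  intro T hT
  have hTs : ∀ a, Commute (star T) (π a) := fun a => by
    have := (show Commute T (π (star a)) from hT (star a)).star_star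
    rwa [← map_star, star_star] at this
  obtain ⟨c, hc⟩ := sa (T + star T) (IsSelfAdjoint.add_star_self T)
    (fun a => Commute.add_left (hT a) (hTs a))
  obtain ⟨d, hd⟩ := sa (Complex.I • (T - star T)) (by
      rw [isSelfAdjoint_iff, star_smul, star_sub, star_star, Complex.star_def, Complex.conj_I]
      module)
    (fun a => (Commute.sub_left (hT a) (hTs a)).smul_left _)
  refine ⟨(1 / 2) * (c - Complex.I * d), ?_⟩
  rw [mul_smul, sub_smul, mul_smul, ← hc, ← hd, smul_smul, Complex.I_mul_I]
  module

end Cyclic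

universe u

open ComplexOrder in
theorem exists_irreducible_separable {A : Type u} [CStarAlgebra A] [PartialOrder A]
    [StarOrderedRing A] [Nontrivial A] [TopologicalSpace.SeparableSpace A] (b : A) :
    ∃ (H : Type u) (_ : NormedAddCommGroup H) (_ : InnerProductSpace ℂ H) (_ : CompleteSpace H)
      (_ : TopologicalSpace.SeparableSpace H) (_ : Nontrivial H) (π : A →⋆ₐ[ℂ] (H →L[ℂ] H)),
      HasTrivialCommutant π ∧ ‖b‖ ≤ ‖π b‖ := by
  obtain ⟨f, hf, hf1, hfc, hext⟩ := exists_extremal_functional (star_mul_self_nonneg b)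
  let F : A →ₚ[ℂ] ℂ := PositiveLinearMap.mk₀ f.toLinearMap
    fun x hx => apply_nonneg_of_norm_le_one f hf hf1 hx
  let π := F.gnsStarAlgHom
  let ξ : F.GNS := ((F.toPreGNS 1 : F.PreGNS) : F.GNS)
  have hπ : ∀ a, π a ξ = ((F.toPreGNS a : F.PreGNS) : F.GNS) := by
    intro a
    simp [π, ξ]
  have hdense : DenseRange fun a => π a ξ := by
    simp_rw [hπ]
    exact UniformSpace.Completion.denseRange_coe.comp F.toPreGNS.surjective.denseRange
      (UniformSpace.Completion.continuous_coe _)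
  have hcont : Continuous fun a => π a ξ := by
    have : Continuous π := map_continuous π
    fun_prop
  have hfξ : ∀ a, f a = inner ℂ ξ (π a ξ) := by
    intro a
    rw [hπ, UniformSpace.Completion.inner_coe, PositiveLinearMap.preGNS_inner_def]
    simp [F]
    rfl
  have hξ1 : ‖ξ‖ = 1 := by
    have := hfξ 1
    rw [hf1, map_one, one_apply_eq_self, inner_self_eq_norm_sq_to_K] at this
    have h2 : ‖ξ‖ ^ 2 = 1 := Complex.ofReal_injective (by simpa using this.symm)
    nlinarith [norm_nonneg ξ]
  refine ⟨F.GNS, inferInstance, inferInstance, inferInstance, hdense.separableSpace hcont,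
    ⟨ξ, 0, fun h => by rw [h, norm_zero] at hξ1; exact zero_ne_one hξ1⟩, π,
    hasTrivialCommutant_of_extremal π ξ hdense hξ1 f hfξ hext, ?_⟩
  have h1 : ‖b‖ ^ 2 ≤ ‖π b‖ ^ 2 := by
    rw [sq, sq, ← CStarRing.norm_star_mul_self, ← CStarRing.norm_star_mul_self, ← map_star,
      ← map_mul]
    calc ‖star b * b‖ = ‖f (star b * b)‖ := by rw [hfc]; simp
      _ ≤ ‖ξ‖ * ‖π (star b * b) ξ‖ := by rw [hfξ]; exact norm_inner_le_norm _ _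
      _ ≤ ‖π (star b * b)‖ := by
        have := (π (star b * b)).le_opNorm ξ
        rw [hξ1] at this ⊢
        linarith
  exact le_of_sq_le_sq h1 (norm_nonneg _)

theorem conjStarAlgEquiv_norm {H L : Type*} [NormedAddCommGroup H] [InnerProductSpace ℂ H]
    [CompleteSpace H] [NormedAddCommGroup L] [InnerProductSpace ℂ L] [CompleteSpace L]
    (e : H ≃ₗᵢ[ℂ] L) (T : H →L[ℂ] H) : ‖e.conjStarAlgEquiv T‖ = ‖T‖ :=
  NonUnitalStarAlgHom.norm_map e.conjStarAlgEquiv e.conjStarAlgEquiv.injective T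

theorem HasTrivialCommutant.conj {A H L : Type*} [CStarAlgebra A] [NormedAddCommGroup H]
    [InnerProductSpace ℂ H] [CompleteSpace H] [NormedAddCommGroup L] [InnerProductSpace ℂ L]
    [CompleteSpace L] {π : A →⋆ₐ[ℂ] (H →L[ℂ] H)} (hπ : HasTrivialCommutant π) (e : H ≃ₗᵢ[ℂ] L) :
    HasTrivialCommutant ((e.conjStarAlgEquiv : (H →L[ℂ] H) →⋆ₐ[ℂ] (L →L[ℂ] L)).comp π) := by
  intro T hT
  obtain ⟨c, hc⟩ := hπ (e.conjStarAlgEquiv.symm T) fun a => by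
    refine EquivLike.injective e.conjStarAlgEquiv ?_
    rw [map_mul, map_mul, StarAlgEquiv.apply_symm_apply]
    exact hT a
  refine ⟨c, ?_⟩
  rw [← e.conjStarAlgEquiv.apply_symm_apply T, hc, map_smul, map_one]

theorem exists_mem_Sigma0_of_hasTrivialCommutant {A H : Type*} [CStarAlgebra A]
    [NormedAddCommGroup H] [InnerProductSpace ℂ H] [CompleteSpace H]
    [TopologicalSpace.SeparableSpace H] [Nontrivial H] (π : A →⋆ₐ[ℂ] (H →L[ℂ] H))
    (hπ : HasTrivialCommutant π) : ∃ σ ∈ Sigma0 A, ∀ a, ‖π a‖ ≤ ‖σ a‖ := by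
  by_cases hH : FiniteDimensional ℂ H
  · set n := Module.finrank ℂ H
    have hn : 0 < n := Module.finrank_pos
    let e : H ≃ₗᵢ[ℂ] EuclideanSpace ℂ (Fin n) := (stdOrthonormalBasis ℂ H).repr
    obtain ⟨u⟩ := nonempty_equiv_lp_lp hn
    let π' : A →⋆ₐ[ℂ] (EuclideanSpace ℂ (Fin n) →L[ℂ] EuclideanSpace ℂ (Fin n)) :=
      (e.conjStarAlgEquiv : (H →L[ℂ] H) →⋆ₐ[ℂ] _).comp π
    let m := Matrix.toEuclideanCLM (n := Fin n) (𝕜 := ℂ)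
    let ρ : A →⋆ₐ[ℂ] Matrix (Fin n) (Fin n) ℂ :=
      (m.symm : _ →⋆ₐ[ℂ] Matrix (Fin n) (Fin n) ℂ).comp π'
    have hρ : ∀ a, m (ρ a) = π' a := fun a => m.apply_symm_apply _
    let σ : RepSp A := (u.symm.conjStarAlgEquiv : _ →⋆ₐ[ℂ] BH).comp
      ((lpMapStarAlgHom (EuclideanSpace ℂ (Fin n))).comp π')
    refine ⟨σ, Or.inr ⟨n, hn, ρ, ?_, u, ?_⟩, fun a => ?_⟩
    · intro T hT
      obtain ⟨c, hc⟩ := hπ.conj e (m T) fun a => by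
        change m T * π' a = π' a * m T
        rw [← hρ, ← map_mul, hT, map_mul]
      refine ⟨c, EquivLike.injective m ?_⟩
      rw [hc, map_smul, map_one]
    · intro a f k
      rw [← Matrix.coe_toEuclideanCLM_eq_toEuclideanLin]
      change u (u.symm (lpMap (π' a) (u (u.symm f)))) k = m (ρ a) (f k)
      rw [hρ, u.apply_symm_apply, u.apply_symm_apply, lpMap_apply]
    · calc ‖π a‖ = ‖π' a‖ := (conjStarAlgEquiv_norm e _).symm
        _ ≤ ‖lpMap (π' a)‖ := norm_le_norm_lpMap _
        _ = ‖σ a‖ := (conjStarAlgEquiv_norm u.symm _).symm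
  · obtain ⟨e⟩ := nonempty_equiv_lp_of_separable H hH
    exact ⟨_, Or.inl (hπ.conj e), fun a => (conjStarAlgEquiv_norm e (π a)).ge⟩

theorem exists_mem_Sigma0_norm_le {A : Type*} [CStarAlgebra A] [PartialOrder A]
    [StarOrderedRing A] [Nontrivial A] [TopologicalSpace.SeparableSpace A] (b : A) :
    ∃ σ ∈ Sigma0 A, ‖b‖ ≤ ‖σ b‖ := by
  obtain ⟨H, _, _, _, _, _, π, hπ, hb⟩ := exists_irreducible_separable b
  obtain ⟨σ, hσ, h⟩ := exists_mem_Sigma0_of_hasTrivialCommutant π hπ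
  exact ⟨σ, hσ, hb.trans (h b)⟩

theorem Sigma0_subset_SigmaSet {A : Type*} [CStarAlgebra A] (K : Set A) :
    Sigma0 A ⊆ SigmaSet K := fun π hπ ε hε => ⟨π, hπ, by simpa [dRep] using hε⟩

theorem norm_sub_le_dRep {A : Type*} [CStarAlgebra A] {K : Set A} (hK : IsCompact K)
    (π₁ π₂ : RepSp A) {x : A} (hx : x ∈ K) : ‖π₁ x - π₂ x‖ ≤ dRep K π₁ π₂ := by
  obtain ⟨C, hC⟩ := hK.isBounded.exists_norm_le
  have hbd : ∀ a ∈ K, ‖π₁ a - π₂ a‖ ≤ C + C := fun a ha =>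
    (norm_sub_le _ _).trans <| add_le_add
      ((NonUnitalStarAlgHom.norm_apply_le π₁ a).trans (hC a ha))
      ((NonUnitalStarAlgHom.norm_apply_le π₂ a).trans (hC a ha))
  have hC0 : 0 ≤ C := (norm_nonneg x).trans (hC x hx)
  have hB : BddAbove (Set.range fun a => ⨆ _ : a ∈ K, ‖π₁ a - π₂ a‖) := by
    refine ⟨C + C, ?_⟩
    rintro _ ⟨a, rfl⟩
    exact Real.iSup_le (hbd a) (by positivity)
  have := le_ciSup hB x
  simpa [dRep, hx] using this

open Filter Topology in
theorem tendsto_apply_of_tendsto_dRep {A : Type*} [CStarAlgebra A] {K : Set A}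
    (hK : IsCompact K) (hgen : Generates K) (π : RepSp A) (v : ℕ → RepSp A)
    (hv : Tendsto (fun n => dRep K (v n) π) atTop (𝓝 0)) (x : A) :
    Tendsto (fun n => v n x) atTop (𝓝 (π x)) := by
  have hx : x ∈ closure (StarAlgebra.adjoin ℂ K : Set A) := by
    rw [← StarSubalgebra.topologicalClosure_coe, hgen]
    trivial
  have hadj : ∀ y ∈ StarAlgebra.adjoin ℂ K, Tendsto (fun n => v n y) atTop (𝓝 (π y)) := by
    intro y hy
    induction hy using StarAlgebra.adjoin_induction with
    | mem y hy =>
      rw [tendsto_iff_norm_sub_tendsto_zero]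
      exact squeeze_zero (fun _ => norm_nonneg _) (fun n => norm_sub_le_dRep hK _ _ hy) hv
    | algebraMap r => simp [AlgHomClass.commutes]
    | add y z _ _ hy hz => simpa only [map_add] using hy.add hz
    | mul y z _ _ hy hz => simpa only [map_mul] using hy.mul hz
    | star y _ hy => simpa only [map_star] using hy.star
  rw [Metric.tendsto_atTop]
  intro ε hε
  obtain ⟨y, hy, hxy⟩ := Metric.mem_closure_iff.1 hx (ε / 3) (by positivity)
  obtain ⟨N, hN⟩ := Metric.tendsto_atTop.1 (hadj y hy) (ε / 3) (by positivity)
  have hlip : ∀ τ : RepSp A, dist (τ x) (τ y) ≤ dist x y := fun τ => by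
    rw [dist_eq_norm, dist_eq_norm, ← map_sub]
    exact NonUnitalStarAlgHom.norm_apply_le τ _
  refine ⟨N, fun n hn => ?_⟩
  have h1 := dist_triangle4 (v n x) (v n y) (π y) (π x)
  have h2 := hlip (v n)
  have h3 := hlip π
  rw [dist_comm] at h3
  have := hN n hn
  linarith

open Filter Topology in
theorem antitone_norm_of_monotone_of_tendsto {B : Type*} [CStarAlgebra B] [PartialOrder B]
    [StarOrderedRing B] {b : ℕ → B} {l : B} (hb : Monotone b)
    (hl : Tendsto (fun n => ‖b n - l‖) atTop (𝓝 0)) : Antitone fun n => ‖b n - l‖ := by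
  have hle : ∀ n, b n ≤ l := fun n => by
    have h0 : Tendsto (fun k => b k - b n) atTop (𝓝 (l - b n)) :=
      (tendsto_iff_norm_sub_tendsto_zero.2 hl).sub_const _
    refine sub_nonneg.1 (CStarAlgebra.isClosed_nonneg.mem_of_tendsto h0 ?_)
    filter_upwards [eventually_ge_atTop n] with k hk
    exact sub_nonneg.2 (hb hk)
  intro m n hmn
  simp only [norm_sub_rev _ l]
  exact CStarAlgebra.norm_le_norm_of_nonneg_of_le (sub_nonneg.2 (hle n))
    (sub_le_sub_left (hb hmn) l)

theorem stmt18 (A : Type*) [CStarAlgebra A] [TopologicalSpace.SeparableSpace A]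
    [PartialOrder A] [StarOrderedRing A]
    (K : Set A) (hK : IsCompact K) (hgen : Generates K)
    (hcomp : RepSeqCompact K (SigmaSet K))
    (a : ℕ → A) (alim : A) (hmono : Monotone a)
    (hpt : ∀ π ∈ SigmaSet (A := A) K,
      Filter.Tendsto (fun n => ‖π (a n) - π alim‖) Filter.atTop (nhds 0)) :
    Filter.Tendsto (fun n => ‖a n - alim‖) Filter.atTop (nhds 0) := by
  rcases subsingleton_or_nontrivial A with hA | hA
  · simp [Subsingleton.elim _ (0 : A)]
  have hanti : ∀ π ∈ SigmaSet (A := A) K, Antitone fun n => ‖π (a n) - π alim‖ := fun π hπ =>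
    antitone_norm_of_monotone_of_tendsto (fun m n h => OrderHomClass.mono π (hmono h)) (hpt π hπ)
  have hle : ∀ (π : RepSp A) (x : A), ‖π x - π alim‖ ≤ ‖x - alim‖ := fun π x => by
    rw [← map_sub]
    exact NonUnitalStarAlgHom.norm_apply_le π _
  choose σ hσ hσn using fun n => exists_mem_Sigma0_norm_le (a n - alim)
  simp only [map_sub] at hσn
  have hσS : ∀ n, σ n ∈ SigmaSet K := fun n => Sigma0_subset_SigmaSet K (hσ n)
  have hA : Antitone fun n => ‖a n - alim‖ := fun m n hmn =>
    (hσn n).trans ((hanti _ (hσS n) hmn).trans (hle _ _))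
  obtain ⟨π, hπ, φ, hφ, hlim⟩ := hcomp σ hσS
  rw [Metric.tendsto_atTop]
  intro ε hε
  obtain ⟨m, hm⟩ := ((hpt π hπ).eventually (gt_mem_nhds hε)).exists
  have hconv : Filter.Tendsto (fun n => ‖σ (φ n) (a m) - σ (φ n) alim‖) Filter.atTop
      (nhds ‖π (a m) - π alim‖) :=
    ((tendsto_apply_of_tendsto_dRep hK hgen π _ hlim (a m)).sub
      (tendsto_apply_of_tendsto_dRep hK hgen π _ hlim alim)).norm
  obtain ⟨n, hn, hmn⟩ := ((hconv.eventually (gt_mem_nhds hm)).and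
    (hφ.tendsto_atTop.eventually_ge_atTop m)).exists
  refine ⟨φ n, fun k hk => ?_⟩
  rw [dist_zero_right, norm_norm]
  calc ‖a k - alim‖ ≤ ‖a (φ n) - alim‖ := hA hk
    _ ≤ ‖σ (φ n) (a (φ n)) - σ (φ n) alim‖ := hσn _
    _ ≤ ‖σ (φ n) (a m) - σ (φ n) alim‖ := hanti _ (hσS _) hmn
    _ < ε := hn
end
end

section
/- Let A and B be unital separable C*-algebras, let K ⊆ A be a compact generating set, and let Hom(A,B) be the set of unital *-homomorphisms A → B equipped with the metric d_K(α,β) := sup_{a∈K} ‖α(a) − β(a)‖. For a family F ⊆ Hom(A,B), the following are equivalent: (1) F is relatively compact in (Hom(A,B), d_K); (2) for every a ∈ A, the set F(a) := {α(a) : α ∈ F} is relatively compact in the norm topology of B. -/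
noncomputable section

/-- The metric `d_K` on `Hom(A,B)`. -/
def dHom {A B : Type*} [CStarAlgebra A] [CStarAlgebra B]
    (K : Set A) (α β : A →⋆ₐ[ℂ] B) : ℝ :=
  ⨆ a ∈ K, ‖α a - β a‖

open Filter Topology

section

variable {A B : Type*} [CStarAlgebra A] [CStarAlgebra B]

theorem norm_starAlgHom_apply_sub_le (α : A →⋆ₐ[ℂ] B) (x y : A) : ‖α x - α y‖ ≤ ‖x - y‖ := by
  rw [← map_sub]
  exact NonUnitalStarAlgHom.norm_apply_le α _

theorem norm_sub_le_dHom {K : Set A} (hK : IsCompact K) (α β : A →⋆ₐ[ℂ] B) {a : A}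
    (ha : a ∈ K) : ‖α a - β a‖ ≤ dHom K α β := by
  obtain ⟨C, hC⟩ := hK.isBounded.exists_norm_le
  have hbdd : BddAbove (Set.range fun a => ⨆ _ : a ∈ K, ‖α a - β a‖) := by
    refine ⟨2 * max C 0, ?_⟩
    rintro _ ⟨x, rfl⟩
    refine Real.iSup_le (fun hx => ?_) (by positivity)
    have h1 := NonUnitalStarAlgHom.norm_apply_le α x
    have h2 := NonUnitalStarAlgHom.norm_apply_le β x
    have h3 := norm_sub_le (α x) (β x)
    have h4 := hC x hx
    have h5 := le_max_left C 0
    linarith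
  refine le_trans ?_ (le_ciSup hbdd a)
  simp [ha]

theorem dHom_nonneg (K : Set A) (α β : A →⋆ₐ[ℂ] B) : 0 ≤ dHom K α β :=
  Real.iSup_nonneg fun _ => Real.iSup_nonneg fun _ => norm_nonneg _

theorem dHom_le {K : Set A} {α β : A →⋆ₐ[ℂ] B} {c : ℝ} (hc : 0 ≤ c)
    (h : ∀ a ∈ K, ‖α a - β a‖ ≤ c) : dHom K α β ≤ c :=
  Real.iSup_le (fun a => Real.iSup_le (h a) hc) hc

theorem isClosed_setOf_tendsto_starAlgHom (u : ℕ → A →⋆ₐ[ℂ] B) (α : A →⋆ₐ[ℂ] B) :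
    IsClosed {a | Tendsto (fun n => u n a) atTop (𝓝 (α a))} := by
  refine isClosed_of_closure_subset fun a ha => ?_
  rw [Set.mem_ofPred_eq, Metric.tendsto_atTop]
  intro ε hε
  obtain ⟨b, hb, hab⟩ := Metric.mem_closure_iff.1 ha (ε / 3) (by positivity)
  obtain ⟨N, hN⟩ := Metric.tendsto_atTop.1 hb (ε / 3) (by positivity)
  refine ⟨N, fun n hn => ?_⟩
  have h1 := hN n hn
  have h2 := norm_starAlgHom_apply_sub_le (u n) a b
  have h3 := norm_starAlgHom_apply_sub_le α a b
  have h4 := dist_triangle4_right (u n a) (α a) (u n b) (α b)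
  simp only [← dist_eq_norm] at h2 h3
  linarith

/-- Convergence of unital star homomorphisms on a generating set implies pointwise convergence. -/
theorem Generates.tendsto_apply {K : Set A} (hgen : Generates K) {u : ℕ → A →⋆ₐ[ℂ] B}
    {α : A →⋆ₐ[ℂ] B} (h : ∀ a ∈ K, Tendsto (fun n => u n a) atTop (𝓝 (α a))) (a : A) :
    Tendsto (fun n => u n a) atTop (𝓝 (α a)) := by
  have hadj : (StarAlgebra.adjoin ℂ K : Set A) ⊆
      {a | Tendsto (fun n => u n a) atTop (𝓝 (α a))} := by
    intro x hx
    induction hx using StarAlgebra.adjoin_induction with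
    | mem x hx => exact h x hx
    | algebraMap r => simp [AlgHomClass.commutes]
    | add x y _ _ hx hy => simpa using Tendsto.add hx hy
    | mul x y _ _ hx hy => simpa using Tendsto.mul hx hy
    | star x _ hx => simpa [map_star] using Tendsto.star hx
  have ha : a ∈ (StarAlgebra.adjoin ℂ K).topologicalClosure := by
    rw [show (StarAlgebra.adjoin ℂ K).topologicalClosure = ⊤ from hgen]
    trivial
  exact closure_minimal hadj (isClosed_setOf_tendsto_starAlgHom u α) ha

theorem cauchySeq_starAlgHom_apply_of_dense {u : ℕ → A →⋆ₐ[ℂ] B} {s : Set A} (hs : Dense s)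
    (h : ∀ a ∈ s, CauchySeq fun n => u n a) (a : A) : CauchySeq fun n => u n a := by
  rw [Metric.cauchySeq_iff]
  intro ε hε
  obtain ⟨b, hb, hab⟩ := Metric.mem_closure_iff.1 (hs a) (ε / 3) (by positivity)
  obtain ⟨N, hN⟩ := Metric.cauchySeq_iff.1 (h b hb) (ε / 3) (by positivity)
  refine ⟨N, fun m hm n hn => ?_⟩
  have h1 := hN m hm n hn
  have h2 := norm_starAlgHom_apply_sub_le (u m) a b
  have h3 := norm_starAlgHom_apply_sub_le (u n) a b
  have h4 := dist_triangle4_right (u m a) (u n a) (u m b) (u n b)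
  simp only [← dist_eq_norm] at h2 h3
  linarith

/-- A pointwise limit of unital star homomorphisms is a unital star homomorphism. -/
theorem exists_starAlgHom_of_tendsto {u : ℕ → A →⋆ₐ[ℂ] B} {f : A → B}
    (h : ∀ a, Tendsto (fun n => u n a) atTop (𝓝 (f a))) : ∃ α : A →⋆ₐ[ℂ] B, ∀ a, α a = f a := by
  refine ⟨{ toFun := f
            map_one' := tendsto_nhds_unique (h 1) (by simp)
            map_mul' := fun x y => tendsto_nhds_unique (h _) (by simpa using (h x).mul (h y))
            map_zero' := tendsto_nhds_unique (h 0) (by simp)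
            map_add' := fun x y => tendsto_nhds_unique (h _) (by simpa using (h x).add (h y))
            commutes' := fun r => tendsto_nhds_unique (h _) (by simp [AlgHomClass.commutes])
            map_star' := fun x => tendsto_nhds_unique (h _)
              (by simpa [map_star] using (h x).star) }, fun _ => rfl⟩

theorem tendsto_dHom_of_tendsto_apply {K : Set A} (hK : IsCompact K) {u : ℕ → A →⋆ₐ[ℂ] B}
    {α : A →⋆ₐ[ℂ] B} (h : ∀ a, Tendsto (fun n => u n a) atTop (𝓝 (α a))) :
    Tendsto (fun n => dHom K (u n) α) atTop (𝓝 0) := by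
  rw [Metric.tendsto_nhds]
  intro ε hε
  obtain ⟨t, -, ht, hKt⟩ := hK.finite_cover_balls (e := ε / 4) (by positivity)
  have hev : ∀ᶠ n in atTop, ∀ b ∈ t, dist (u n b) (α b) < ε / 4 :=
    (eventually_all_finite ht).2 fun b _ => Metric.tendsto_nhds.1 (h b) _ (by positivity)
  filter_upwards [hev] with n hn
  rw [Real.dist_0_eq_abs, abs_of_nonneg (dHom_nonneg _ _ _)]
  refine lt_of_le_of_lt (dHom_le (c := 3 * (ε / 4)) (by positivity) fun a ha => ?_)
    (by linarith)
  obtain ⟨b, hb, hab⟩ := Set.mem_iUnion₂.1 (hKt ha)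
  rw [Metric.mem_ball] at hab
  have h1 := hn b hb
  have h2 := norm_starAlgHom_apply_sub_le (u n) a b
  have h3 := norm_starAlgHom_apply_sub_le α a b
  have h4 := dist_triangle4_right (u n a) (α a) (u n b) (α b)
  simp only [← dist_eq_norm] at h2 h3 ⊢
  linarith

/-- A sequence of unital star homomorphisms out of a separable algebra with relatively compact
orbits has a subsequence converging pointwise. -/
theorem exists_subseq_tendsto_starAlgHom [TopologicalSpace.SeparableSpace A]
    {u : ℕ → A →⋆ₐ[ℂ] B} {S : A → Set B} (hS : ∀ a, IsCompact (S a)) (hu : ∀ n a, u n a ∈ S a) :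
    ∃ α : A →⋆ₐ[ℂ] B, ∃ φ : ℕ → ℕ, StrictMono φ ∧
      ∀ a, Tendsto (fun n => u (φ n) a) atTop (𝓝 (α a)) := by
  let d := TopologicalSpace.denseSeq A
  obtain ⟨g, -, φ, hφ, hg⟩ := (isCompact_univ_pi fun k => hS (d k)).tendsto_subseq
    (x := fun n k => u n (d k)) fun n k _ => hu n (d k)
  have hcauchy := cauchySeq_starAlgHom_apply_of_dense (u := fun n => u (φ n))
    (TopologicalSpace.denseRange_denseSeq A)
    (by rintro _ ⟨k, rfl⟩; exact (tendsto_pi_nhds.1 hg k).cauchySeq)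
  choose f hf using fun a => cauchySeq_tendsto_of_complete (hcauchy a)
  obtain ⟨α, hα⟩ := exists_starAlgHom_of_tendsto hf
  exact ⟨α, φ, hφ, fun a => hα a ▸ hf a⟩

end

theorem isCompact_closure_of_exists_subseq {X : Type*} [PseudoMetricSpace X] {s : Set X}
    (h : ∀ v : ℕ → X, (∀ n, v n ∈ s) →
      ∃ b, ∃ φ : ℕ → ℕ, StrictMono φ ∧ Tendsto (fun n => v (φ n)) atTop (𝓝 b)) :
    IsCompact (closure s) := by
  refine IsSeqCompact.isCompact fun x hx => ?_
  choose v hv hxv using fun n =>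
    Metric.mem_closure_iff.1 (hx n) (1 / ((n : ℝ) + 1)) (by positivity)
  obtain ⟨b, φ, hφ, hb⟩ := h v hv
  refine ⟨b, mem_closure_of_tendsto hb (Eventually.of_forall fun n => hv _), φ, hφ, ?_⟩
  have hdist : Tendsto (fun n => dist (v n) (x n)) atTop (𝓝 0) :=
    squeeze_zero (fun _ => dist_nonneg) (fun n => (dist_comm _ _).trans_le (hxv n).le)
      tendsto_one_div_add_atTop_nhds_zero_nat
  exact hb.congr_dist (hdist.comp hφ.tendsto_atTop)

theorem stmt19 (A B : Type*) [CStarAlgebra A] [CStarAlgebra B]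
    [TopologicalSpace.SeparableSpace A] [TopologicalSpace.SeparableSpace B]
    (K : Set A) (hK : IsCompact K) (hgen : Generates K)
    (F : Set (A →⋆ₐ[ℂ] B)) :
    -- `F` is relatively compact in the complete metric space `(Hom(A,B), d_K)`,
    -- i.e. every sequence in `F` has a subsequence converging in `Hom(A,B)`
    (∀ u : ℕ → (A →⋆ₐ[ℂ] B), (∀ n, u n ∈ F) →
      ∃ α : A →⋆ₐ[ℂ] B, ∃ φ : ℕ → ℕ, StrictMono φ ∧
        Filter.Tendsto (fun n => dHom K (u (φ n)) α) Filter.atTop (nhds 0)) ↔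
    -- for every `a ∈ A`, the set `F(a)` is relatively compact in `B`
    (∀ a : A, IsCompact (closure {b : B | ∃ α ∈ F, b = α a})) := by
  constructor
  · intro h a
    refine isCompact_closure_of_exists_subseq fun v hv => ?_
    choose u huF hu using hv
    obtain ⟨α, φ, hφ, hα⟩ := h u huF
    refine ⟨α a, φ, hφ, ?_⟩
    simp only [hu]
    refine hgen.tendsto_apply (u := fun n => u (φ n)) (fun b hb => ?_) a
    rw [tendsto_iff_norm_sub_tendsto_zero]
    exact squeeze_zero (fun _ => norm_nonneg _) (fun n => norm_sub_le_dHom hK _ _ hb) hα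
  · intro h u hu
    obtain ⟨α, φ, hφ, hα⟩ := exists_subseq_tendsto_starAlgHom h
      fun n a => subset_closure ⟨u n, hu n, rfl⟩
    exact ⟨α, φ, hφ, tendsto_dHom_of_tendsto_apply hK hα⟩
end
end
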